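/- arXiv:2410.22021 — 2 statements merged into one kernel-verified Lean document; each statement's English description precedes it below -/
import Mathlib

section
/- Let G be a simple graph on a finite vertex type, and let B be a set of vertices of G that is independent (no two vertices of B are adjacent), such that the subgraph of G induced on the complement of B is bipartite (2-colorable), and such that every vertex w in B has neighborhood in G equal to the set of four vertices of some cycle of length 4 of the subgraph induced on the complement of B. Then G is perfect: for every subset S of the vertices, the clique number of the induced subgraph G[S] equals the chromatic number of G[S]. -/
open SimpleGraph

/-- A finite 3-colorable graph has equal clique and chromatic numbers as soon as
triangle-freeness makes it 2-colorable. -/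
theorem SimpleGraph.cliqueNum_eq_chromaticNumber_of_colorable_three {V : Type*} [Finite V]
    (H : SimpleGraph V) (h₃ : H.Colorable 3) (h₂ : H.CliqueFree 3 → H.Colorable 2) :
    (H.cliqueNum : ℕ∞) = H.chromaticNumber := by
  classical
  have clique_le (s : Finset V) (hs : H.IsClique s) : s.card ≤ H.cliqueNum :=
    hs.card_le_cliqueNum
  refine le_antisymm H.cliqueNum_le_chromaticNumber ?_
  suffices ∃ n ≤ H.cliqueNum, H.Colorable n by
    obtain ⟨n, hn, hc⟩ := this
    exact hc.chromaticNumber_le.trans (by exact_mod_cast hn)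
  by_cases hf : H.CliqueFree 3
  · by_cases he : ∃ a b, H.Adj a b
    · obtain ⟨a, b, hab⟩ := he
      refine ⟨2, ?_, h₂ hf⟩
      have := clique_le {a, b} (by simp [hab])
      rwa [Finset.card_pair hab.ne] at this
    · push Not at he
      rcases isEmpty_or_nonempty V with hV | ⟨⟨a⟩⟩
      · exact ⟨0, Nat.zero_le _, Colorable.of_isEmpty 0⟩
      · refine ⟨1, ?_, ⟨Coloring.mk (fun _ => 0) fun {u v} h => (he u v h).elim⟩⟩
        simpa using clique_le {a} (by simp)
  · simp only [CliqueFree, not_forall, not_not] at hf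
    obtain ⟨s, hs⟩ := hf
    exact ⟨3, hs.card_eq ▸ clique_le s hs.isClique, h₃⟩

/-- If `B` is an independent set of vertices of `G` such that the subgraph
induced on the complement of `B` is bipartite and every vertex of `B` has neighborhood
equal to the vertex set of some 4-cycle of the subgraph induced on the complement of `B`,
then `G` is perfect: for every vertex subset `S`, the clique number of the induced
subgraph `G[S]` equals its chromatic number. -/
theorem stellated_bipartite_perfect {α : Type*} [Fintype α] (G : SimpleGraph α)
    (B : Set α)
    (hind : ∀ x ∈ B, ∀ y ∈ B, ¬ G.Adj x y)
    (hbip : (G.induce Bᶜ).Colorable 2)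
    (hcyc : ∀ w ∈ B, ∃ x₁ x₂ x₃ x₄ : α,
      x₁ ∈ Bᶜ ∧ x₂ ∈ Bᶜ ∧ x₃ ∈ Bᶜ ∧ x₄ ∈ Bᶜ ∧
      x₁ ≠ x₃ ∧ x₂ ≠ x₄ ∧
      G.Adj x₁ x₂ ∧ G.Adj x₂ x₃ ∧ G.Adj x₃ x₄ ∧ G.Adj x₄ x₁ ∧
      G.neighborSet w = {x₁, x₂, x₃, x₄}) :
    ∀ S : Set α, (((G.induce S).cliqueNum : ℕ∞)) = (G.induce S).chromaticNumber := by
  classical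
  obtain ⟨C⟩ := hbip
  let c : α → Fin 2 := fun v => if h : v ∈ Bᶜ then C ⟨v, h⟩ else 0
  have hc {u v : α} (hu : u ∉ B) (hv : v ∉ B) (h : G.Adj u v) : c u ≠ c v := by
    have := C.valid (v := ⟨u, hu⟩) (w := ⟨v, hv⟩) h
    simpa [c, hu, hv] using this
  have hmem {w u : α} (hw : w ∈ B) (h : G.Adj w u) : u ∉ B := fun hu => hind w hw u hu h
  have hadj {w u v : α} (hw : w ∈ B) (hu : G.Adj w u) (hv : G.Adj w v) (huv : c u ≠ c v) :
      G.Adj u v := by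
    obtain ⟨x₁, x₂, x₃, x₄, h₁, h₂, h₃, h₄, -, -, h₁₂, h₂₃, h₃₄, h₄₁, hN⟩ := hcyc w hw
    have c₁₂ := hc h₁ h₂ h₁₂
    have c₂₃ := hc h₂ h₃ h₂₃
    have c₃₄ := hc h₃ h₄ h₃₄
    have c₄₁ := hc h₄ h₁ h₄₁
    have e₁₃ : c x₁ = c x₃ := by omega
    have e₂₄ : c x₂ = c x₄ := by omega
    rw [← mem_neighborSet, hN] at hu hv
    rcases hu with rfl | rfl | rfl | rfl <;> rcases hv with rfl | rfl | rfl | rfl <;>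
      first
      | assumption
      | exact Adj.symm (by assumption)
      | exact absurd rfl huv
      | exact absurd e₁₃ huv
      | exact absurd e₁₃.symm huv
      | exact absurd e₂₄ huv
      | exact absurd e₂₄.symm huv
  intro S
  apply cliqueNum_eq_chromaticNumber_of_colorable_three
  · refine ⟨Coloring.mk (fun v => if v.1 ∈ B then 2 else (c v).castSucc) ?_⟩
    intro u v h
    have h : G.Adj u v := h
    by_cases hu : u.1 ∈ B
    · have hv := hmem hu h
      simp only [hu, hv, if_true, if_false]
      exact (Fin.castSucc_lt_last _).ne'
    · by_cases hv : v.1 ∈ B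
      · simp only [hu, hv, if_true, if_false]
        exact (Fin.castSucc_lt_last _).ne
      · simpa [hu, hv] using hc hu hv h
  · intro hf
    have hmono {w u v : α} (hwS : w ∈ S) (huS : u ∈ S) (hvS : v ∈ S) (hw : w ∈ B)
        (hu : G.Adj w u) (hv : G.Adj w v) : c u = c v := by
      by_contra huv
      refine hf {⟨w, hwS⟩, ⟨u, huS⟩, ⟨v, hvS⟩} ?_
      rw [is3Clique_triple_iff]
      exact ⟨hu, hv, hadj hw hu hv huv⟩
    let d : S → Fin 2 := fun v =>
      if v.1 ∈ B then (if ∃ u ∈ S, G.Adj v u ∧ c u = 0 then 1 else 0) else c v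
    have hd {w u : S} (hw : w.1 ∈ B) (h : G.Adj w u) : d w ≠ d u := by
      have hu := hmem hw h
      simp only [d, hw, hu, if_true, if_false]
      split_ifs with he
      · obtain ⟨x, hxS, hx, hx0⟩ := he
        rw [← hmono w.2 hxS u.2 hw hx h, hx0]
        decide
      · exact fun h0 => he ⟨u, u.2, h, h0.symm⟩
    refine ⟨Coloring.mk d ?_⟩
    intro u v h
    have h : G.Adj u v := h
    by_cases hu : u.1 ∈ B
    · exact hd hu h
    · by_cases hv : v.1 ∈ B
      · exact (hd hv h.symm).symm
      · simpa [d, hu, hv] using hc hu hv h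
end

section
/- Let G be a simple graph on a finite vertex type, and let B be a nonempty set of vertices of G that is independent (no two vertices of B are adjacent), such that the subgraph of G induced on the complement of B is bipartite (2-colorable), and such that every vertex w in B has neighborhood in G equal to the set of four vertices of some cycle of length 4 of the subgraph induced on the complement of B. Then the clique number of G equals 3 and the chromatic number of G equals 3. -/
open SimpleGraph

/-- Giving an independent set a fresh color extends a coloring of its complement. -/
theorem SimpleGraph.Colorable.succ_of_induce_compl {V : Type*} {G : SimpleGraph V} {s : Set V}
    {n : ℕ} (hs : ∀ x ∈ s, ∀ y ∈ s, ¬ G.Adj x y) (h : (G.induce sᶜ).Colorable n) :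
    G.Colorable (n + 1) := by
  classical
  obtain ⟨c⟩ := h
  refine ⟨Coloring.mk (fun v => if hv : v ∈ s then Fin.last n else (c ⟨v, hv⟩).castSucc) ?_⟩
  intro v w hvw
  by_cases hv : v ∈ s <;> by_cases hw : w ∈ s
  · exact absurd hvw (hs v hv w hw)
  · simpa [hv, hw] using (Fin.castSucc_lt_last _).ne'
  · simp [hv, hw]
  · have hc : c ⟨v, hv⟩ ≠ c ⟨w, hw⟩ := c.valid (by simpa using hvw)
    simpa [hv, hw] using hc

/-- If `B` is a nonempty independent set of vertices of `G` such that the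
subgraph induced on the complement of `B` is bipartite and every vertex of `B` has
neighborhood equal to the vertex set of some 4-cycle of the subgraph induced on the
complement of `B`, then the clique number of `G` equals 3 and the chromatic number of
`G` equals 3. -/
theorem stellated_bipartite_cliqueNum_chromaticNumber {α : Type*} [Fintype α]
    (G : SimpleGraph α) (B : Set α)
    (hne : B.Nonempty)
    (hind : ∀ x ∈ B, ∀ y ∈ B, ¬ G.Adj x y)
    (hbip : (G.induce Bᶜ).Colorable 2)
    (hcyc : ∀ w ∈ B, ∃ x₁ x₂ x₃ x₄ : α,
      x₁ ∈ Bᶜ ∧ x₂ ∈ Bᶜ ∧ x₃ ∈ Bᶜ ∧ x₄ ∈ Bᶜ ∧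
      x₁ ≠ x₃ ∧ x₂ ≠ x₄ ∧
      G.Adj x₁ x₂ ∧ G.Adj x₂ x₃ ∧ G.Adj x₃ x₄ ∧ G.Adj x₄ x₁ ∧
      G.neighborSet w = {x₁, x₂, x₃, x₄}) :
    G.cliqueNum = 3 ∧ G.chromaticNumber = 3 := by
  classical
  have hcol : G.Colorable 3 := hbip.succ_of_induce_compl hind
  obtain ⟨w, hw⟩ := hne
  obtain ⟨x₁, x₂, x₃, x₄, -, -, -, -, -, -, h₁₂, -, -, -, hN⟩ := hcyc w hw
  have h₁ : G.Adj w x₁ := by simp [← mem_neighborSet, hN]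
  have h₂ : G.Adj w x₂ := by simp [← mem_neighborSet, hN]
  have hclique : G.IsNClique 3 {w, x₁, x₂} := is3Clique_triple_iff.mpr ⟨h₁, h₂, h₁₂⟩
  have hle : 3 ≤ G.cliqueNum := hclique.card_eq ▸ hclique.isClique.card_le_cliqueNum
  constructor
  · refine le_antisymm ?_ hle
    obtain ⟨t, ht⟩ := G.exists_isNClique_cliqueNum
    exact ht.card_eq ▸ ht.isClique.card_le_of_colorable hcol
  · refine le_antisymm hcol.chromaticNumber_le ?_
    have := hclique.isClique.card_le_chromaticNumber
    rwa [hclique.card_eq] at this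
end
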